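/- Completeness of the negation fragment with respect to the three-element algebra: for all Γ ∪ {φ} ⊆ 𝔉_{{¬}} (formulas built from letters using only ¬), Γ ⊢_{{¬}} φ if and only if Γ ⊨_𝟑 φ, where 𝟑 is the algebra on {0, 1/2, 1} with ¬0 = 1 and ¬(1/2) = ¬1 = 0, and designated set D = {1}. In particular, the fragments {¬} and {∧,¬} of intuitionistic logic have finite semantics. -/

import Mathlib

/-- The four propositional connectives. -/
inductive Conn : Type
  | conj | disj | impl | nega
deriving DecidableEq

/-- Propositional formulas over countably many letters `p₀, p₁, …`. -/
inductive PropForm : Type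
  | var : ℕ → PropForm
  | and : PropForm → PropForm → PropForm
  | or : PropForm → PropForm → PropForm
  | imp : PropForm → PropForm → PropForm
  | neg : PropForm → PropForm

/-- The set of connectives occurring in a formula. -/
def PropForm.conns : PropForm → Set Conn
  | .var _ => ∅
  | .and a b => insert .conj (a.conns ∪ b.conns)
  | .or a b => insert .disj (a.conns ∪ b.conns)
  | .imp a b => insert .impl (a.conns ∪ b.conns)
  | .neg a => insert .nega a.conns

/-- `φ ∈ 𝔉_F` : the formula `φ` uses only connectives belonging to the fragment `F`. -/
def InFrag (F : Set Conn) (φ : PropForm) : Prop := φ.conns ⊆ F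

/-- Derivability `Γ ⊢_F φ` for the fragment `F`: the least relation closed under
membership, monotonicity, cut, and the two directions of the rules
(R∧), (R∨), (R→), (R¬I), (R¬E) for the connectives in `F`. -/
inductive Deriv (F : Set Conn) : Set PropForm → PropForm → Prop
  | mem {Γ : Set PropForm} {φ : PropForm} : φ ∈ Γ → Deriv F Γ φ
  | mono {Γ : Set PropForm} {φ ψ : PropForm} : Deriv F Γ φ → Deriv F (insert ψ Γ) φ
  | cut {Γ Δ : Set PropForm} {φ ψ : PropForm} :
      Deriv F Γ φ → Deriv F (insert φ Δ) ψ → Deriv F (Γ ∪ Δ) ψ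
  | andI {Γ : Set PropForm} {φ ψ : PropForm} :
      Conn.conj ∈ F → Deriv F Γ φ → Deriv F Γ ψ → Deriv F Γ (.and φ ψ)
  | andE1 {Γ : Set PropForm} {φ ψ : PropForm} :
      Conn.conj ∈ F → Deriv F Γ (.and φ ψ) → Deriv F Γ φ
  | andE2 {Γ : Set PropForm} {φ ψ : PropForm} :
      Conn.conj ∈ F → Deriv F Γ (.and φ ψ) → Deriv F Γ ψ
  | orI {Γ : Set PropForm} {φ ψ χ : PropForm} :
      Conn.disj ∈ F → Deriv F (insert φ Γ) χ → Deriv F (insert ψ Γ) χ →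
      Deriv F (insert (.or φ ψ) Γ) χ
  | orE1 {Γ : Set PropForm} {φ ψ χ : PropForm} :
      Conn.disj ∈ F → Deriv F (insert (.or φ ψ) Γ) χ → Deriv F (insert φ Γ) χ
  | orE2 {Γ : Set PropForm} {φ ψ χ : PropForm} :
      Conn.disj ∈ F → Deriv F (insert (.or φ ψ) Γ) χ → Deriv F (insert ψ Γ) χ
  | impI {Γ : Set PropForm} {φ ψ : PropForm} :
      Conn.impl ∈ F → Deriv F (insert φ Γ) ψ → Deriv F Γ (.imp φ ψ)
  | impE {Γ : Set PropForm} {φ ψ : PropForm} :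
      Conn.impl ∈ F → Deriv F Γ (.imp φ ψ) → Deriv F (insert φ Γ) ψ
  | negI {Γ : Set PropForm} {φ ψ : PropForm} :
      Conn.nega ∈ F → Deriv F (insert φ Γ) ψ → Deriv F (insert φ Γ) (.neg ψ) →
      Deriv F Γ (.neg φ)
  | negE {Γ : Set PropForm} {φ ψ : PropForm} :
      Conn.nega ∈ F → Deriv F Γ φ → Deriv F Γ (.neg φ) → Deriv F Γ ψ

/-- An algebra interpreting the connectives on a carrier `V`. -/
structure Alg (V : Type) where
  and : V → V → V
  or : V → V → V
  imp : V → V → V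
  neg : V → V

/-- The homomorphic extension of an assignment `v` of letters. -/
def Alg.eval {V : Type} (A : Alg V) (v : ℕ → V) : PropForm → V
  | .var n => v n
  | .and a b => A.and (A.eval v a) (A.eval v b)
  | .or a b => A.or (A.eval v a) (A.eval v b)
  | .imp a b => A.imp (A.eval v a) (A.eval v b)
  | .neg a => A.neg (A.eval v a)

/-- Semantic consequence `Γ ⊨_{A,D} φ`. -/
def SemConseq {V : Type} (A : Alg V) (D : Set V) (Γ : Set PropForm) (φ : PropForm) : Prop :=
  ∀ v : ℕ → V, (∀ ψ ∈ Γ, A.eval v ψ ∈ D) → A.eval v φ ∈ D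

/-- The fragment `F` has a finite semantics. -/
def HasFiniteSemantics (F : Set Conn) : Prop :=
  ∃ (V : Type) (_ : Fintype V) (A : Alg V) (D : Set V),
    ∀ (Γ : Set PropForm) (φ : PropForm),
      (∀ ψ ∈ Γ, InFrag F ψ) → InFrag F φ →
      (Deriv F Γ φ ↔ SemConseq A D Γ φ)

/-- `φ ∨̇ ψ = (φ → ψ) → ψ`. -/
def dvee (a b : PropForm) : PropForm := .imp (.imp a b) b

/-- Left-associated iterated `∨̇` of a list of formulas. -/
def bigDvee : List PropForm → PropForm
  | [] => .var 0
  | a :: rest => rest.foldl dvee a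

/-- Left-associated iterated `∨` of a list of formulas. -/
def bigOrF : List PropForm → PropForm
  | [] => .var 0
  | a :: rest => rest.foldl PropForm.or a

/-- All pairs `(i, j)` with `1 ≤ i < j ≤ n+1`. -/
def pairs (n : ℕ) : List (ℕ × ℕ) :=
  (List.range' 2 n).flatMap fun j => (List.range' 1 (j - 1)).map fun i => (i, j)

/-- `α_n = ∨̇_{1 ≤ i < j ≤ n+1} (p_j → p_i)`. -/
def alphaImp (n : ℕ) : PropForm :=
  bigDvee ((pairs n).map fun p => .imp (.var p.2) (.var p.1))

/-- `α_n = ⋁_{1 ≤ i < j ≤ n+1} ¬¬(¬p_i ∨ p_j)`. -/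
def alphaOrNeg (n : ℕ) : PropForm :=
  bigOrF ((pairs n).map fun p => .neg (.neg (.or (.neg (.var p.1)) (.var p.2))))

/-- Two-valued Boolean evaluation. -/
def evalBool (v : ℕ → Bool) : PropForm → Bool
  | .var n => v n
  | .and a b => evalBool v a && evalBool v b
  | .or a b => evalBool v a || evalBool v b
  | .imp a b => !evalBool v a || evalBool v b
  | .neg a => !evalBool v a

/-- Classical (two-valued) consequence `Γ ⊢_c φ`. -/
def ClassConseq (Γ : Set PropForm) (φ : PropForm) : Prop :=
  ∀ v : ℕ → Bool, (∀ ψ ∈ Γ, evalBool v ψ = true) → evalBool v φ = true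

/-- The two-element Boolean algebra `𝟐`. -/
def alg2 : Alg Bool where
  and a b := a && b
  or a b := a || b
  imp a b := !a || b
  neg a := !a

/-- The three-element algebra `𝟑` on the chain `0 < 1/2 < 1` (coded as `0 < 1 < 2` in `Fin 3`),
with meet `min` and meet complement `¬0 = 1`, `¬(1/2) = ¬1 = 0` (its `or`/`imp` are those of the
3-element Heyting chain). -/
def alg3 : Alg (Fin 3) where
  and a b := min a b
  or a b := max a b
  imp a b := if a ≤ b then 2 else b
  neg a := if a = 0 then 2 else 0

/-- The `(n+1)`-element Heyting chain, coded on `Fin (n+1)` (so `k` codes the element `k+1`). -/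
def chainAlg (n : ℕ) : Alg (Fin (n + 1)) where
  and a b := min a b
  or a b := max a b
  imp a b := if a ≤ b then Fin.last n else b
  neg a := if a = 0 then Fin.last n else 0

/-- The map `𝟑 → 𝟑` sending `0` to `0` and every other element to the top. -/
def collapse (a : Fin 3) : Fin 3 := if a = 0 then 0 else 2

theorem alg3_eval_collapse (v : ℕ → Fin 3) (φ : PropForm) :
    alg3.eval (fun n => collapse (v n)) φ = collapse (alg3.eval v φ) := by
  have hand : ∀ a b, alg3.and (collapse a) (collapse b) = collapse (alg3.and a b) := by decide
  have hor : ∀ a b, alg3.or (collapse a) (collapse b) = collapse (alg3.or a b) := by decide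
  have himp : ∀ a b, alg3.imp (collapse a) (collapse b) = collapse (alg3.imp a b) := by decide
  have hneg : ∀ a, alg3.neg (collapse a) = collapse (alg3.neg a) := by decide
  induction φ with
  | var n => rfl
  | and a b iha ihb => simp only [Alg.eval, iha, ihb, hand]
  | or a b iha ihb => simp only [Alg.eval, iha, ihb, hor]
  | imp a b iha ihb => simp only [Alg.eval, iha, ihb, himp]
  | neg a iha => simp only [Alg.eval, iha, hneg]

/-- If `φ` has a nonzero value under a model of `Γ`, then every consequence of `Γ, φ`
has a nonzero value. -/
theorem SemConseq.eval_ne_zero {Γ : Set PropForm} {φ ψ : PropForm}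
    (h : SemConseq alg3 {2} (insert φ Γ) ψ) {v : ℕ → Fin 3}
    (hv : ∀ χ ∈ Γ, alg3.eval v χ ∈ ({2} : Set (Fin 3))) (hφ : alg3.eval v φ ≠ 0) :
    alg3.eval v ψ ≠ 0 := by
  have := h (fun n => collapse (v n)) (by
    rintro χ (rfl | hχ)
    · rw [alg3_eval_collapse, collapse, if_neg hφ]
      rfl
    · rw [alg3_eval_collapse, Set.mem_singleton_iff.1 (hv χ hχ)]
      rfl)
  rw [alg3_eval_collapse] at this
  intro h0
  simp [h0, collapse] at this

/-- Every rule is sound for the three-element Heyting chain. -/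
theorem Deriv.semConseq_alg3 {F : Set Conn} {Γ : Set PropForm} {φ : PropForm}
    (h : Deriv F Γ φ) : SemConseq alg3 {2} Γ φ := by
  have hand : ∀ a b, alg3.and a b = 2 ↔ a = 2 ∧ b = 2 := by decide
  have hor : ∀ a b, alg3.or a b = 2 ↔ a = 2 ∨ b = 2 := by decide
  have himp : ∀ a b, (a = 2 → b = 2) → (a ≠ 0 → b ≠ 0) → alg3.imp a b = 2 := by decide
  have hmp : ∀ b, alg3.imp 2 b = 2 → b = 2 := by decide
  have hneg : ∀ a, alg3.neg a = 2 ↔ a = 0 := by decide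
  have hneg0 : ∀ a, alg3.neg a ≠ 0 → a = 0 := by decide
  induction h with
  | mem h => exact fun v hv => hv _ h
  | mono _ ih => exact fun v hv => ih v fun χ hχ => hv χ (Or.inr hχ)
  | cut _ _ ih₁ ih₂ =>
    intro v hv
    refine ih₂ v ?_
    rintro χ (rfl | hχ)
    · exact ih₁ v fun χ hχ => hv χ (Or.inl hχ)
    · exact hv χ (Or.inr hχ)
  | andI _ _ _ ih₁ ih₂ => exact fun v hv => (hand _ _).2 ⟨ih₁ v hv, ih₂ v hv⟩
  | andE1 _ _ ih => exact fun v hv => ((hand _ _).1 (ih v hv)).1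
  | andE2 _ _ ih => exact fun v hv => ((hand _ _).1 (ih v hv)).2
  | orI _ _ _ ih₁ ih₂ =>
    intro v hv
    rw [Set.forall_mem_insert] at hv
    rcases (hor _ _).1 hv.1 with h | h
    · exact ih₁ v (Set.forall_mem_insert.2 ⟨h, hv.2⟩)
    · exact ih₂ v (Set.forall_mem_insert.2 ⟨h, hv.2⟩)
  | orE1 _ _ ih =>
    intro v hv
    rw [Set.forall_mem_insert] at hv
    exact ih v (Set.forall_mem_insert.2 ⟨(hor _ _).2 (Or.inl hv.1), hv.2⟩)
  | orE2 _ _ ih =>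
    intro v hv
    rw [Set.forall_mem_insert] at hv
    exact ih v (Set.forall_mem_insert.2 ⟨(hor _ _).2 (Or.inr hv.1), hv.2⟩)
  | impI _ _ ih =>
    exact fun v hv => himp _ _ (fun h => ih v (Set.forall_mem_insert.2 ⟨h, hv⟩))
      (ih.eval_ne_zero hv)
  | @impE Γ φ ψ _ _ ih =>
    intro v hv
    rw [Set.forall_mem_insert] at hv
    have h : alg3.imp (alg3.eval v φ) (alg3.eval v ψ) = 2 := ih v hv.2
    rw [show alg3.eval v φ = 2 from hv.1] at h
    exact hmp _ h
  | negI _ _ _ ih₁ ih₂ =>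
    intro v hv
    refine (hneg _).2 ?_
    by_contra h
    exact ih₁.eval_ne_zero hv h (hneg0 _ (ih₂.eval_ne_zero hv h))
  | @negE Γ φ ψ _ _ _ ih₁ ih₂ =>
    intro v hv
    have h₀ : alg3.eval v φ = 0 := (hneg _).1 (ih₂ v hv)
    have h₂ : alg3.eval v φ = 2 := ih₁ v hv
    simp [h₀] at h₂

theorem Deriv.weaken {F : Set Conn} {Γ Δ : Set PropForm} {φ : PropForm}
    (h : Deriv F Γ φ) (hs : Γ ⊆ Δ) : Deriv F Δ φ := by
  have := Deriv.cut h (Deriv.mem (Set.mem_insert φ Δ))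
  rwa [Set.union_eq_right.2 hs] at this

theorem Deriv.cut_self {F : Set Conn} {Γ : Set PropForm} {φ ψ : PropForm}
    (h₁ : Deriv F Γ φ) (h₂ : Deriv F (insert φ Γ) ψ) : Deriv F Γ ψ := by
  simpa using Deriv.cut h₁ h₂

theorem Deriv.exists_finite {F : Set Conn} (hF : F ⊆ {Conn.conj, Conn.nega})
    {Γ : Set PropForm} {φ : PropForm} (h : Deriv F Γ φ) :
    ∃ Γ₀ ⊆ Γ, Γ₀.Finite ∧ Deriv F Γ₀ φ := by
  have hins : ∀ (Γ₀ : Set PropForm) (χ : PropForm), Γ₀ ⊆ insert χ (Γ₀ \ {χ}) := by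
    intro Γ₀ χ
    simp
  induction h with
  | @mem Γ φ h =>
    exact ⟨{φ}, Set.singleton_subset_iff.2 h, Set.finite_singleton φ, .mem rfl⟩
  | mono _ ih =>
    obtain ⟨Γ₀, hs, hf, hd⟩ := ih
    exact ⟨Γ₀, hs.trans (Set.subset_insert _ _), hf, hd⟩
  | @cut Γ Δ φ ψ _ _ ih₁ ih₂ =>
    obtain ⟨Γ₁, hs₁, hf₁, hd₁⟩ := ih₁
    obtain ⟨Γ₂, hs₂, hf₂, hd₂⟩ := ih₂
    exact ⟨Γ₁ ∪ Γ₂ \ {φ}, Set.union_subset_union hs₁ (Set.sdiff_singleton_subset_iff.2 hs₂),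
      hf₁.union hf₂.sdiff, .cut hd₁ (hd₂.weaken (hins _ _))⟩
  | andI hc _ _ ih₁ ih₂ =>
    obtain ⟨Γ₁, hs₁, hf₁, hd₁⟩ := ih₁
    obtain ⟨Γ₂, hs₂, hf₂, hd₂⟩ := ih₂
    exact ⟨Γ₁ ∪ Γ₂, Set.union_subset hs₁ hs₂, hf₁.union hf₂,
      .andI hc (hd₁.weaken Set.subset_union_left) (hd₂.weaken Set.subset_union_right)⟩
  | andE1 hc _ ih =>
    obtain ⟨Γ₀, hs, hf, hd⟩ := ih
    exact ⟨Γ₀, hs, hf, .andE1 hc hd⟩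
  | andE2 hc _ ih =>
    obtain ⟨Γ₀, hs, hf, hd⟩ := ih
    exact ⟨Γ₀, hs, hf, .andE2 hc hd⟩
  | orI hc => simpa using hF hc
  | orE1 hc => simpa using hF hc
  | orE2 hc => simpa using hF hc
  | impI hc => simpa using hF hc
  | impE hc => simpa using hF hc
  | @negI Γ φ ψ hc _ _ ih₁ ih₂ =>
    obtain ⟨Γ₁, hs₁, hf₁, hd₁⟩ := ih₁
    obtain ⟨Γ₂, hs₂, hf₂, hd₂⟩ := ih₂
    refine ⟨(Γ₁ ∪ Γ₂) \ {φ}, Set.sdiff_singleton_subset_iff.2 (Set.union_subset hs₁ hs₂),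
      (hf₁.union hf₂).sdiff, .negI hc (hd₁.weaken ?_) (hd₂.weaken ?_)⟩
    · exact Set.subset_union_left.trans (hins _ _)
    · exact Set.subset_union_right.trans (hins _ _)
  | negE hc _ _ ih₁ ih₂ =>
    obtain ⟨Γ₁, hs₁, hf₁, hd₁⟩ := ih₁
    obtain ⟨Γ₂, hs₂, hf₂, hd₂⟩ := ih₂
    exact ⟨Γ₁ ∪ Γ₂, Set.union_subset hs₁ hs₂, hf₁.union hf₂,
      .negE hc (hd₁.weaken Set.subset_union_left) (hd₂.weaken Set.subset_union_right)⟩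

/-- No formula is derivable together with its negation. -/
def Consistent (F : Set Conn) (Γ : Set PropForm) : Prop :=
  ∀ ψ, Deriv F Γ ψ → ¬ Deriv F Γ (.neg ψ)

theorem Consistent.exists_maximal {F : Set Conn} (hF : F ⊆ {Conn.conj, Conn.nega})
    {Γ : Set PropForm} (h : Consistent F Γ) : ∃ Δ, Γ ⊆ Δ ∧ Maximal (Consistent F) Δ := by
  refine zorn_subset_nonempty {Δ | Consistent F Δ} (fun c hc hchain hne => ?_) Γ h
  refine ⟨⋃₀ c, fun ψ h₁ h₂ => ?_, fun s => Set.subset_sUnion_of_mem⟩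
  obtain ⟨Γ₁, hs₁, hf₁, hd₁⟩ := h₁.exists_finite hF
  obtain ⟨Γ₂, hs₂, hf₂, hd₂⟩ := h₂.exists_finite hF
  obtain ⟨Δ, hΔ, hsub⟩ := hchain.directedOn.exists_mem_subset_of_finite_of_subset_sUnion hne
    (hf₁.union hf₂) (Set.union_subset hs₁ hs₂)
  exact hc hΔ ψ (hd₁.weaken (Set.subset_union_left.trans hsub))
    (hd₂.weaken (Set.subset_union_right.trans hsub))

theorem Consistent.mem_of_deriv {F : Set Conn} {Δ : Set PropForm}
    (h : Maximal (Consistent F) Δ) {ψ : PropForm} (hψ : Deriv F Δ ψ) : ψ ∈ Δ :=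
  h.le_of_ge (y := insert ψ Δ)
    (fun χ h₁ h₂ => h.prop χ (hψ.cut_self h₁) (hψ.cut_self h₂))
    (Set.subset_insert _ _) (Set.mem_insert _ _)

theorem Consistent.neg_mem_iff {F : Set Conn} (hn : Conn.nega ∈ F) {Δ : Set PropForm}
    (h : Maximal (Consistent F) Δ) {ψ : PropForm} : ψ.neg ∈ Δ ↔ ψ ∉ Δ := by
  refine ⟨fun h₁ h₂ => h.prop ψ (.mem h₂) (.mem h₁), fun hψ => ?_⟩
  have : ¬ Consistent F (insert ψ Δ) := fun hc =>
    hψ (h.le_of_ge hc (Set.subset_insert _ _) (Set.mem_insert _ _))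
  simp only [Consistent, not_forall, not_not] at this
  obtain ⟨χ, h₁, h₂⟩ := this
  exact mem_of_deriv h (.negI hn h₁ h₂)

open Classical in
/-- The assignment giving the top value to the letters derivable from `Γ` and the middle value
to the other letters of `Δ`. -/
noncomputable def canonicalAssignment (F : Set Conn) (Γ Δ : Set PropForm) (n : ℕ) : Fin 3 :=
  if Deriv F Γ (.var n) then 2 else if .var n ∈ Δ then 1 else 0

theorem InFrag.and_iff {F : Set Conn} {a b : PropForm} :
    InFrag F (.and a b) ↔ Conn.conj ∈ F ∧ InFrag F a ∧ InFrag F b := by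
  simp [InFrag, PropForm.conns, Set.insert_subset_iff]

theorem InFrag.neg_iff {F : Set Conn} {a : PropForm} :
    InFrag F (.neg a) ↔ Conn.nega ∈ F ∧ InFrag F a := by
  simp [InFrag, PropForm.conns, Set.insert_subset_iff]

theorem not_inFrag_or {F : Set Conn} (hF : F ⊆ {Conn.conj, Conn.nega}) (a b : PropForm) :
    ¬ InFrag F (.or a b) := fun h => by
  simpa using hF (h (Set.mem_insert _ _))

theorem not_inFrag_imp {F : Set Conn} (hF : F ⊆ {Conn.conj, Conn.nega}) (a b : PropForm) :
    ¬ InFrag F (.imp a b) := fun h => by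
  simpa using hF (h (Set.mem_insert _ _))

theorem eval_canonicalAssignment_ne_zero_iff {F : Set Conn} (hn : Conn.nega ∈ F)
    (hF : F ⊆ {Conn.conj, Conn.nega}) {Γ Δ : Set PropForm} (hs : Γ ⊆ Δ)
    (hΔ : Maximal (Consistent F) Δ) {ψ : PropForm} (hψ : InFrag F ψ) :
    alg3.eval (canonicalAssignment F Γ Δ) ψ ≠ 0 ↔ ψ ∈ Δ := by
  have hand : ∀ a b, alg3.and a b ≠ 0 ↔ a ≠ 0 ∧ b ≠ 0 := by decide
  have hneg : ∀ a, alg3.neg a ≠ 0 ↔ ¬ a ≠ 0 := by decide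
  induction ψ with
  | var n =>
    have : Deriv F Γ (.var n) → .var n ∈ Δ := fun h =>
      Consistent.mem_of_deriv hΔ (h.weaken hs)
    simp only [Alg.eval, canonicalAssignment]
    split_ifs <;> simp_all
  | and a b iha ihb =>
    obtain ⟨hc, ha, hb⟩ := InFrag.and_iff.1 hψ
    refine ((hand _ _).trans (and_congr (iha ha) (ihb hb))).trans ?_
    exact ⟨fun h => Consistent.mem_of_deriv hΔ (.andI hc (.mem h.1) (.mem h.2)),
      fun h => ⟨Consistent.mem_of_deriv hΔ (.andE1 hc (.mem h)),
        Consistent.mem_of_deriv hΔ (.andE2 hc (.mem h))⟩⟩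
  | or a b => exact absurd hψ (not_inFrag_or hF a b)
  | imp a b => exact absurd hψ (not_inFrag_imp hF a b)
  | neg a iha =>
    exact ((hneg _).trans (not_congr (iha (InFrag.neg_iff.1 hψ).2))).trans
      (Consistent.neg_mem_iff hn hΔ).symm

theorem Deriv.eval_canonicalAssignment {F : Set Conn} (hn : Conn.nega ∈ F)
    (hF : F ⊆ {Conn.conj, Conn.nega}) {Γ Δ : Set PropForm} (hs : Γ ⊆ Δ)
    (hΔ : Maximal (Consistent F) Δ) {ψ : PropForm} (hψ : InFrag F ψ) (h : Deriv F Γ ψ) :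
    alg3.eval (canonicalAssignment F Γ Δ) ψ = 2 := by
  have hneg : ∀ a, alg3.neg a ≠ 0 → alg3.neg a = 2 := by decide
  induction ψ with
  | var n => simp [Alg.eval, canonicalAssignment, h]
  | and a b iha ihb =>
    obtain ⟨hc, ha, hb⟩ := InFrag.and_iff.1 hψ
    rw [Alg.eval, iha ha (.andE1 hc h), ihb hb (.andE2 hc h)]
    rfl
  | or a b => exact absurd hψ (not_inFrag_or hF a b)
  | imp a b => exact absurd hψ (not_inFrag_imp hF a b)
  | neg a =>
    exact hneg _ ((eval_canonicalAssignment_ne_zero_iff hn hF hs hΔ hψ).2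
      (Consistent.mem_of_deriv hΔ (h.weaken hs)))

theorem SemConseq.deriv_of_alg3 {F : Set Conn} (hn : Conn.nega ∈ F)
    (hF : F ⊆ {Conn.conj, Conn.nega}) {Γ : Set PropForm} {φ : PropForm}
    (hΓ : ∀ ψ ∈ Γ, InFrag F ψ) (hφ : InFrag F φ) (h : SemConseq alg3 {2} Γ φ) :
    Deriv F Γ φ := by
  have key : ∀ Δ, Γ ⊆ Δ → Maximal (Consistent F) Δ → ∀ {χ}, SemConseq alg3 {2} Γ χ →
      alg3.eval (canonicalAssignment F Γ Δ) χ = 2 := fun Δ hs hΔ χ h =>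
    h _ fun ψ hψ => (Deriv.mem hψ).eval_canonicalAssignment hn hF hs hΔ (hΓ ψ hψ)
  induction φ with
  | var n =>
    by_contra hd
    obtain ⟨Δ, hs, hΔ⟩ := Consistent.exists_maximal hF (Γ := Γ)
      fun ψ h₁ h₂ => hd (.negE hn h₁ h₂)
    have := key Δ hs hΔ h
    simp only [Alg.eval, canonicalAssignment, hd, if_false] at this
    split_ifs at this <;> simp at this
  | and a b iha ihb =>
    have hand : ∀ a b, alg3.and a b = 2 → a = 2 ∧ b = 2 := by decide
    obtain ⟨hc, ha, hb⟩ := InFrag.and_iff.1 hφ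
    exact .andI hc (iha ha fun v hv => (hand _ _ (h v hv)).1)
      (ihb hb fun v hv => (hand _ _ (h v hv)).2)
  | or a b => exact absurd hφ (not_inFrag_or hF a b)
  | imp a b => exact absurd hφ (not_inFrag_imp hF a b)
  | neg a =>
    have hneg : ∀ a, alg3.neg a = 2 → a = 0 := by decide
    by_contra hd
    obtain ⟨Δ, hs, hΔ⟩ := Consistent.exists_maximal hF (Γ := insert a Γ)
      fun ψ h₁ h₂ => hd (.negI hn h₁ h₂)
    have hs' : Γ ⊆ Δ := (Set.subset_insert _ _).trans hs
    exact (eval_canonicalAssignment_ne_zero_iff hn hF hs' hΔ (InFrag.neg_iff.1 hφ).2).2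
      (hs (Set.mem_insert _ _)) (hneg _ (key Δ hs' hΔ h))

theorem deriv_iff_semConseq_alg3 {F : Set Conn} (hn : Conn.nega ∈ F)
    (hF : F ⊆ {Conn.conj, Conn.nega}) {Γ : Set PropForm} {φ : PropForm}
    (hΓ : ∀ ψ ∈ Γ, InFrag F ψ) (hφ : InFrag F φ) :
    Deriv F Γ φ ↔ SemConseq alg3 {2} Γ φ :=
  ⟨Deriv.semConseq_alg3, SemConseq.deriv_of_alg3 hn hF hΓ hφ⟩

/-- completeness of the `{¬}`-fragment w.r.t. the three-element
algebra `𝟑` (universe `{0, 1/2, 1}` coded as `Fin 3`) with designated set `{1}`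
(coded `{2}`); in particular, the fragments `{¬}` and `{∧, ¬}` have finite
semantics. -/
theorem neg_fragment_three_valued (Γ : Set PropForm) (φ : PropForm)
    (hΓ : ∀ ψ ∈ Γ, InFrag {Conn.nega} ψ) (hφ : InFrag {Conn.nega} φ) :
    (Deriv {Conn.nega} Γ φ ↔ SemConseq alg3 {2} Γ φ) ∧
    HasFiniteSemantics {Conn.nega} ∧ HasFiniteSemantics {Conn.conj, Conn.nega} := by
  refine ⟨deriv_iff_semConseq_alg3 (Set.mem_singleton _) (by simp) hΓ hφ,
    ⟨Fin 3, inferInstance, alg3, {2}, fun _ _ h₁ h₂ => ?_⟩,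
    ⟨Fin 3, inferInstance, alg3, {2}, fun _ _ h₁ h₂ => ?_⟩⟩
  · exact deriv_iff_semConseq_alg3 (Set.mem_singleton _) (by simp) h₁ h₂
  · exact deriv_iff_semConseq_alg3 (by simp) subset_rfl h₁ h₂
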